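/- Counterfactual identification under confounded labels: let U_CD, U_C, U_D, U_I be finite independent random variables (with a product probability mass function), let C = f_C(U_CD, U_C), D = f_D(U_CD, U_D), and I = f_I(C, D, U_I) for measurable maps into finite domains, and let I_[D=d] := f_I(C, d, U_I) denote the potential response of I under the intervention D ← d. If P(D = d') > 0 and P(C = c, D = d) > 0 for every c with P(C = c, D = d') > 0, then for every i: P(I_[D=d] = i | D = d') = Σ_c P(I = i | D = d, C = c) · P(C = c | D = d'), where the sum ranges over c with P(C = c | D = d') > 0. -/

import Mathlib

set_option linter.unusedVariables false

open Classical

/-- The probability of the event `E` under the mass function `μ` on the finite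
sample space `Ω`. -/
noncomputable def PrI {Ω : Type*} [Fintype Ω] (μ : Ω → ℝ) (E : Ω → Prop) : ℝ :=
  ∑ ω : Ω, if E ω then μ ω else 0

theorem PrI_nonneg {Ω : Type*} [Fintype Ω] {μ : Ω → ℝ} (hμ : ∀ ω, 0 ≤ μ ω) (E : Ω → Prop) :
    0 ≤ PrI μ E := by
  unfold PrI
  refine Finset.sum_nonneg fun ω _ => ?_
  split_ifs
  · exact hμ ω
  · exact le_rfl

/-- Law of total probability over the values of a finite-valued random variable. -/
theorem PrI_eq_sum_fiber {Ω κ : Type*} [Fintype Ω] [Fintype κ] (μ : Ω → ℝ) (E : Ω → Prop)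
    (X : Ω → κ) : PrI μ E = ∑ c, PrI μ (fun ω => E ω ∧ X ω = c) := by
  unfold PrI
  rw [Finset.sum_comm]
  refine Finset.sum_congr rfl fun ω _ => ?_
  by_cases h : E ω <;> simp [h]

/-- Under a product mass function, an event about the last coordinate is independent of an event
about the other three. -/
theorem PrI_and_last_of_prod {α β γ δ : Type*} [Fintype α] [Fintype β] [Fintype γ] [Fintype δ]
    {a : α → ℝ} {b : β → ℝ} {g : γ → ℝ} {p : δ → ℝ} (hp : ∑ u, p u = 1)
    {μ : α × β × γ × δ → ℝ} (hμ : ∀ ω, μ ω = a ω.1 * b ω.2.1 * g ω.2.2.1 * p ω.2.2.2)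
    (E : α → β → γ → Prop) (F : δ → Prop) :
    PrI μ (fun ω => E ω.1 ω.2.1 ω.2.2.1 ∧ F ω.2.2.2)
      = PrI μ (fun ω => E ω.1 ω.2.1 ω.2.2.1) * PrI p F := by
  unfold PrI
  simp only [Fintype.sum_prod_type, hμ, Finset.sum_mul]
  refine Finset.sum_congr rfl fun x _ => Finset.sum_congr rfl fun y _ =>
    Finset.sum_congr rfl fun z _ => ?_
  by_cases h : E x y z
  · simp only [h, true_and, if_true]
    rw [← Finset.sum_mul, ← Finset.mul_sum, hp, mul_one, Finset.mul_sum]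
    simp only [mul_ite, mul_zero]
  · simp [h]

/-- **Counterfactual identification under confounded labels.**
Independent finite exogenous variables `U_CD, U_C, U_D, U_I` with product mass
function `μ`; mechanisms `C = fC(u_CD, u_C)`, `D = fD(u_CD, u_D)`,
`I = fI(C, D, u_I)`; `Iint d` is the potential response of `I` under the intervention
`D ← d`.  If `P(D = d') > 0` and `P(C = c, D = d) > 0` for every `c` with
`P(C = c, D = d') > 0`, then
`P(I_[D=d] = i | D = d') = Σ_c P(I = i | D = d, C = c) · P(C = c | D = d')`, the sum
ranging over `c` with `P(C = c | D = d') > 0`. -/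
theorem counterfactual_id_confounded_labels
    {UCD UC UD UI ΩC ΩD ΩI : Type*}
    [Fintype UCD] [Fintype UC] [Fintype UD] [Fintype UI]
    [Fintype ΩC] [Fintype ΩD] [Fintype ΩI]
    (pCD : UCD → ℝ) (pC : UC → ℝ) (pD : UD → ℝ) (pI : UI → ℝ)
    (hCD0 : ∀ u, 0 ≤ pCD u) (hC0 : ∀ u, 0 ≤ pC u) (hD0 : ∀ u, 0 ≤ pD u)
    (hI0 : ∀ u, 0 ≤ pI u)
    (hCD1 : ∑ u : UCD, pCD u = 1) (hC1 : ∑ u : UC, pC u = 1)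
    (hD1 : ∑ u : UD, pD u = 1) (hI1 : ∑ u : UI, pI u = 1)
    (fC : UCD → UC → ΩC) (fD : UCD → UD → ΩD) (fI : ΩC → ΩD → UI → ΩI)
    (μ : UCD × UC × UD × UI → ℝ)
    (hμ : ∀ ω, μ ω = pCD ω.1 * pC ω.2.1 * pD ω.2.2.1 * pI ω.2.2.2)
    (C : UCD × UC × UD × UI → ΩC) (hC : ∀ ω, C ω = fC ω.1 ω.2.1)
    (Dv : UCD × UC × UD × UI → ΩD) (hDv : ∀ ω, Dv ω = fD ω.1 ω.2.2.1)
    (I : UCD × UC × UD × UI → ΩI) (hI : ∀ ω, I ω = fI (C ω) (Dv ω) ω.2.2.2)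
    (Iint : ΩD → UCD × UC × UD × UI → ΩI)
    (hIint : ∀ d ω, Iint d ω = fI (C ω) d ω.2.2.2)
    (d d' : ΩD) (i : ΩI)
    (hd' : 0 < PrI μ (fun ω => Dv ω = d'))
    (hpos : ∀ c : ΩC, 0 < PrI μ (fun ω => C ω = c ∧ Dv ω = d') →
      0 < PrI μ (fun ω => C ω = c ∧ Dv ω = d)) :
    PrI μ (fun ω => Iint d ω = i ∧ Dv ω = d') / PrI μ (fun ω => Dv ω = d')
      = ∑ c ∈ Finset.univ.filter
            (fun c : ΩC =>
              0 < PrI μ (fun ω => C ω = c ∧ Dv ω = d')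
                    / PrI μ (fun ω => Dv ω = d')),
          PrI μ (fun ω => I ω = i ∧ Dv ω = d ∧ C ω = c)
              / PrI μ (fun ω => Dv ω = d ∧ C ω = c)
            * (PrI μ (fun ω => C ω = c ∧ Dv ω = d')
                / PrI μ (fun ω => Dv ω = d')) := by
  have hμ0 : ∀ ω, 0 ≤ μ ω := fun ω => by
    rw [hμ]
    exact mul_nonneg (mul_nonneg (mul_nonneg (hCD0 _) (hC0 _)) (hD0 _)) (hI0 _)
  have response (c : ΩC) (e : ΩD) :
      PrI μ (fun ω => (C ω = c ∧ Dv ω = e) ∧ fI c d ω.2.2.2 = i)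
        = PrI μ (fun ω => C ω = c ∧ Dv ω = e) * PrI pI (fun u => fI c d u = i) := by
    simp only [hC, hDv]
    exact PrI_and_last_of_prod hI1 hμ (fun x y z => fC x y = c ∧ fD x z = e)
      (fun u => fI c d u = i)
  have numerator : PrI μ (fun ω => Iint d ω = i ∧ Dv ω = d')
      = ∑ c, PrI μ (fun ω => C ω = c ∧ Dv ω = d') * PrI pI (fun u => fI c d u = i) := by
    rw [PrI_eq_sum_fiber μ _ C]
    refine Finset.sum_congr rfl fun c _ => ?_
    rw [← response]
    congr 1
    funext ω
    rw [hIint]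
    grind
  rw [numerator, Finset.sum_div, Finset.sum_filter]
  refine Finset.sum_congr rfl fun c _ => ?_
  have observed : PrI μ (fun ω => I ω = i ∧ Dv ω = d ∧ C ω = c)
      = PrI μ (fun ω => Dv ω = d ∧ C ω = c) * PrI pI (fun u => fI c d u = i) := by
    have swap : (fun ω => Dv ω = d ∧ C ω = c) = fun ω => C ω = c ∧ Dv ω = d :=
      funext fun ω => propext and_comm
    rw [swap, ← response]
    congr 1
    funext ω
    rw [hI]
    grind
  split_ifs with h
  · have hc : 0 < PrI μ (fun ω => Dv ω = d ∧ C ω = c) := by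
      simpa only [and_comm] using hpos c ((div_pos_iff_of_pos_right hd').1 h)
    rw [observed, mul_div_cancel_left₀ _ hc.ne']
    ring
  · have hc : PrI μ (fun ω => C ω = c ∧ Dv ω = d') = 0 :=
      le_antisymm (not_lt.1 fun hlt => h (div_pos hlt hd')) (PrI_nonneg hμ0 _)
    rw [hc, zero_mul, zero_div]
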